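/- arXiv:0902.0804 — 5 statements merged into one kernel-verified Lean document; each statement's English description precedes it below -/
import Mathlib

section
/- Let G(γ) = Σ_{i=1}^N C_i · γ^{α_i} with complex C_i, α_i, and assume the equation Σ_{i=1}^N C_i/(λ + α_i + 1) = 1 has N distinct complex roots σ_1, …, σ_N; set σ(G) = max_{1≤i≤N} Re(σ_i). Consider the sequence defined by ξ_p = (1/p) · Σ_{q=2}^{p−1} G(q/p) · ξ_q for p ≥ 3, with ξ_2 a parameter. Then there exists a constant C depending only on G such that |ξ_p| ≤ C · p^{σ(G)} · |ξ_2| for all p > 1. -/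
open Complex Finset
open Filter Asymptotics Topology

/-- First order expansion of `(1 + z) ^ γ` at `z = 0`. -/
theorem one_add_cpow_isBigO (γ : ℂ) :
    (fun z : ℂ => (1 + z) ^ γ - (1 + γ * z)) =O[𝓝 0] fun z => z ^ 2 := by
  have h := (one_add_cpow_hasFPowerSeriesAt_zero (a := γ)).isBigO_sub_partialSum_pow 2
  simp_rw [← norm_pow] at h
  simpa [FormalMultilinearSeries.partialSum, Finset.sum_range_succ, binomialSeries, mul_comm] using
    h.of_norm_right

/-- A nonnegative sequence whose consecutive ratios are at most `1 + c / n ^ 2` is bounded. -/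
theorem bounded_of_step (a : ℕ → ℝ) (ha : ∀ n, 0 ≤ a n) (c : ℝ) (hc : 0 ≤ c)
    (h : ∀ᶠ n : ℕ in atTop, a (n + 1) ≤ (1 + c / (n : ℝ) ^ 2) * a n) :
    a =O[atTop] fun _ => (1 : ℝ) := by
  obtain ⟨P, hP⟩ := eventually_atTop.1 h
  have hs : Summable fun n : ℕ => c / (n : ℝ) ^ 2 := by
    simpa [div_eq_mul_inv] using (Real.summable_one_div_nat_pow.2 one_lt_two).mul_left c
  have hpos : ∀ n : ℕ, 0 ≤ c / (n : ℝ) ^ 2 := fun n => by positivity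
  have key : ∀ n, P ≤ n → a n ≤ a P * Real.exp (∑ q ∈ Finset.Ico P n, c / (q : ℝ) ^ 2) := by
    intro n hn
    induction n, hn using Nat.le_induction with
    | base => simp
    | succ n hn ih =>
      rw [Finset.sum_Ico_succ_top hn, Real.exp_add]
      calc a (n + 1) ≤ (1 + c / (n : ℝ) ^ 2) * a n := hP n hn
        _ ≤ Real.exp (c / (n : ℝ) ^ 2) *
            (a P * Real.exp (∑ q ∈ Finset.Ico P n, c / (q : ℝ) ^ 2)) := by
          gcongr
          · exact ha n
          · linarith [Real.add_one_le_exp (c / (n : ℝ) ^ 2)]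
        _ = _ := by ring
  refine IsBigO.of_bound (a P * Real.exp (∑' n : ℕ, c / (n : ℝ) ^ 2)) ?_
  filter_upwards [eventually_ge_atTop P] with n hn
  rw [Real.norm_of_nonneg (ha n), norm_one, mul_one]
  refine (key n hn).trans ?_
  gcongr
  · exact ha P
  · exact hs.sum_le_tsum _ fun i _ => hpos i

theorem norm_one_add_le {w : ℂ} (hw : w.re ≤ 0) : ‖1 + w‖ ≤ 1 + ‖w‖ ^ 2 := by
  refine abs_le_of_sq_le_sq' ?_ (by positivity) |>.2
  have h1 := Complex.sq_norm (1 + w)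
  have h2 := Complex.sq_norm w
  rw [Complex.normSq_apply] at h1 h2
  simp at h1
  nlinarith [sq_nonneg (‖w‖ ^ 2)]

/-- If `A` is diagonalizable with eigenvalues of nonpositive real part, then perturbations of size
`O(‖v p‖ / p ^ 2)` of the recursion `v (p + 1) = v p + A (v p) / p` have bounded solutions. -/
theorem isBigO_one_of_eigenbasis {ι E : Type*} [Fintype ι] [NormedAddCommGroup E] [NormedSpace ℂ E]
    (A : Module.End ℂ E) (B : Module.Basis ι ℂ E) (μ : ι → ℂ)
    (hB : ∀ k, A (B k) = μ k • B k) (hμ : ∀ k, (μ k).re ≤ 0) (v : ℕ → E)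
    (hv : (fun p : ℕ => v (p + 1) - v p - (1 / (p : ℂ)) • A (v p)) =O[atTop]
      fun p : ℕ => ‖v p‖ / (p : ℝ) ^ 2) :
    v =O[atTop] fun _ => (1 : ℝ) := by
  set T := B.equivFunL with hT
  have hTA : ∀ x k, T (A x) k = μ k * T x k := by
    intro x k
    have : (LinearMap.proj k ∘ₗ B.equivFun.toLinearMap) ∘ₗ A =
        μ k • (LinearMap.proj k ∘ₗ B.equivFun.toLinearMap) := by
      refine B.ext fun j => ?_
      by_cases hjk : j = k <;> simp [hB, hjk]
    exact LinearMap.congr_fun this x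
  have hle : (fun p : ℕ => T (v (p + 1) - v p - (1 / (p : ℂ)) • A (v p))) =O[atTop]
      fun p : ℕ => ‖T (v p)‖ / (p : ℝ) ^ 2 :=
    ((T.isBigO_comp _ _).trans hv).trans
      ((T.isBigO_comp_rev v atTop).norm_norm.mul (isBigO_refl (fun p : ℕ => ((p : ℝ) ^ 2)⁻¹) _))
  obtain ⟨c, hc, hle⟩ := hle.exists_nonneg
  refine (T.isBigO_comp_rev v atTop).trans (IsBigO.of_norm_left ?_)
  refine bounded_of_step _ (fun _ => norm_nonneg _) (c + ‖μ‖ ^ 2) (by positivity) ?_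
  filter_upwards [hle.bound] with p hp
  have hstep : T (v (p + 1)) = T (v (p + 1) - v p - (1 / (p : ℂ)) • A (v p)) +
      fun k => (1 + μ k / p) * T (v p) k := by
    ext k
    simp [hTA]
    ring
  rw [hstep]
  refine (norm_add_le _ _).trans ?_
  rw [Real.norm_of_nonneg (by positivity)] at hp
  have h2 : ‖fun k => (1 + μ k / p) * T (v p) k‖ ≤ (1 + ‖μ‖ ^ 2 / (p : ℝ) ^ 2) * ‖T (v p)‖ := by
    refine (pi_norm_le_iff_of_nonneg (by positivity)).2 fun k => ?_
    rw [norm_mul]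
    gcongr
    · refine (norm_one_add_le ?_).trans ?_
      · rw [Complex.div_natCast_re]
        exact div_nonpos_of_nonpos_of_nonneg (hμ k) (Nat.cast_nonneg p)
      · rw [norm_div, Complex.norm_natCast, div_pow]
        gcongr
        exact norm_le_pi_norm μ k
    · exact norm_le_pi_norm (T (v p)) k
  refine (add_le_add hp h2).trans (le_of_eq ?_)
  ring

/-- The matrix `-diag β + 1 Cᵀ` is diagonalizable, with the roots of `∑ C i / (σ + β i) = 1` as
eigenvalues, when it has as many distinct roots as its size. -/
theorem exists_eigenbasis {ι : Type*} [Fintype ι] (C β σ : ι → ℂ)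
    (hσ : Function.Injective σ) (hden : ∀ k i, σ k + β i ≠ 0)
    (hroot : ∀ k, ∑ i, C i / (σ k + β i) = 1) (A : Module.End ℂ (ι → ℂ))
    (hA : ∀ x i, A x i = -β i * x i + ∑ j, C j * x j) :
    ∃ B : Module.Basis ι ℂ (ι → ℂ), ∀ k, A (B k) = σ k • B k := by
  cases isEmpty_or_nonempty ι
  · exact ⟨Pi.basisFun ℂ ι, fun k => isEmptyElim k⟩
  have hw : ∀ k, A (fun i => (σ k + β i)⁻¹) = σ k • fun i => (σ k + β i)⁻¹ := by
    intro k
    ext i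
    have := hroot k
    simp only [div_eq_mul_inv] at this
    rw [hA, this, Pi.smul_apply, smul_eq_mul]
    field_simp [hden k i]
    ring
  have hli := Module.End.eigenvectors_linearIndependent' A σ hσ
    (fun k i => (σ k + β i)⁻¹) fun k => ⟨Module.End.mem_eigenspace_iff.2 (hw k), fun h =>
      inv_ne_zero (hden k k) (congrFun h k)⟩
  refine ⟨basisOfLinearIndependentOfCardEqFinrank hli (by simp), fun k => ?_⟩
  simpa using hw k

/-- The case of nonpositive characteristic exponent: the solutions of the recurrence are bounded. -/
theorem isBigO_one_of_recurrence {ι : Type*} [Fintype ι] (C α σ : ι → ℂ)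
    (hσ : Function.Injective σ) (hden : ∀ k i, σ k + (α i + 1) ≠ 0)
    (hroot : ∀ k, ∑ i, C i / (σ k + (α i + 1)) = 1) (hre : ∀ k, (σ k).re ≤ 0) (η : ℕ → ℂ)
    (hrec : ∀ p : ℕ, 3 ≤ p → η p = (1 / (p : ℂ)) * ∑ q ∈ Finset.Ico 2 p,
      (∑ i, C i * ((q : ℂ) / p) ^ α i) * η q) :
    η =O[atTop] fun _ => (1 : ℝ) := by
  let L : (ι → ℂ) →ₗ[ℂ] ℂ := ∑ j, C j • LinearMap.proj j
  have hL : ∀ x, L x = ∑ j, C j * x j := fun x => by simp [L]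
  let A : Module.End ℂ (ι → ℂ) := LinearMap.pi fun i => -(α i + 1) • LinearMap.proj i + L
  have hA : ∀ x i, A x i = -(α i + 1) * x i + L x := fun x i => by simp [A]
  obtain ⟨B, hB⟩ := exists_eigenbasis C (fun i => α i + 1) σ hσ hden hroot A
    fun x i => by rw [hA, hL]
  let v : ℕ → ι → ℂ := fun p i =>
    (p : ℂ) ^ (-(α i + 1)) * ∑ q ∈ Finset.Ico 2 p, (q : ℂ) ^ α i * η q
  have hηv : ∀ p, 3 ≤ p → η p = L (v p) := by
    intro p hp
    have hp0 : (p : ℂ) ≠ 0 := Nat.cast_ne_zero.2 (by omega)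
    rw [hrec p hp, hL]
    simp only [v, Finset.sum_mul, Finset.mul_sum]
    rw [Finset.sum_comm]
    refine Finset.sum_congr rfl fun i _ => Finset.sum_congr rfl fun q _ => ?_
    have hdiv : ((q : ℂ) / p) ^ α i = (q : ℂ) ^ α i / (p : ℂ) ^ α i := by
      simpa using div_cpow_ofReal_nonneg q.cast_nonneg p.cast_nonneg (α i)
    rw [hdiv, cpow_neg, cpow_add _ _ hp0, cpow_one]
    field_simp
  have hvstep : ∀ p, 3 ≤ p → ∀ i, v (p + 1) i =
      (1 + (p : ℂ)⁻¹) ^ (-(α i + 1)) * (v p i + L (v p) / p) := by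
    intro p hp i
    have hp0 : (p : ℂ) ≠ 0 := Nat.cast_ne_zero.2 (by omega)
    have hmul : ((p + 1 : ℕ) : ℂ) ^ (-(α i + 1)) =
        (1 + (p : ℂ)⁻¹) ^ (-(α i + 1)) * (p : ℂ) ^ (-(α i + 1)) := by
      have := mul_cpow_ofReal_nonneg (a := 1 + (p : ℝ)⁻¹) (b := p) (by positivity) (by positivity)
        (-(α i + 1))
      push_cast at this
      rw [← this]
      congr 1
      push_cast
      field_simp
    rw [← hηv p hp]
    simp only [v]
    rw [hmul, Finset.sum_Ico_succ_top (by omega), mul_assoc, mul_add]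
    congr 2
    rw [cpow_neg, cpow_add _ _ hp0, cpow_one]
    have : (p : ℂ) ^ α i ≠ 0 := by simp [cpow_eq_zero_iff, hp0]
    field_simp
  have hLO : (fun p => L (v p)) =O[atTop] fun p => ‖v p‖ :=
    (L.toContinuousLinearMap.isBigO_comp v atTop).norm_right
  have hinv : Tendsto (fun p : ℕ => (p : ℂ)⁻¹) atTop (𝓝 0) := tendsto_inv_atTop_nhds_zero_nat
  have hvO : v =O[atTop] fun _ => (1 : ℝ) := by
    refine isBigO_one_of_eigenbasis A B σ hB hre v (isBigO_pi.2 fun i => ?_)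
    have hr := (one_add_cpow_isBigO (-(α i + 1))).comp_tendsto hinv
    have hvi : (fun p => v p i) =O[atTop] fun p => ‖v p‖ :=
      IsBigO.of_bound 1 (Eventually.of_forall fun p => by simpa using norm_le_pi_norm (v p) i)
    have hinvO : (fun p : ℕ => (p : ℂ)⁻¹) =O[atTop] fun _ => (1 : ℝ) := hinv.isBigO_one ℝ
    have hsum : (fun p => v p i + L (v p) * (p : ℂ)⁻¹) =O[atTop] fun p => ‖v p‖ := by
      exact hvi.add (by simpa using hLO.mul hinvO)
    have hsq : (fun p : ℕ => ((p : ℂ)⁻¹) ^ 2) =O[atTop] fun p : ℕ => ((p : ℝ) ^ 2)⁻¹ :=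
      IsBigO.of_bound 1 (Eventually.of_forall fun p => by simp)
    have hmain := ((hr.trans hsq).mul hsum).add ((hsq.mul hLO).const_mul_left (-(α i + 1)))
    refine hmain.congr' ?_ (Eventually.of_forall fun p => by simp [div_eq_inv_mul])
    filter_upwards [eventually_ge_atTop 3] with p hp
    simp only [Pi.sub_apply, Pi.smul_apply, smul_eq_mul, hvstep p hp i, hA, Function.comp_apply]
    ring
  exact ((hLO.trans hvO.norm_left).congr' (by
    filter_upwards [eventually_ge_atTop 3] with p hp using (hηv p hp).symm) .rfl)

/-- Theorem 4.2: if `G(γ) = Σ_i C_i γ^{α_i}` and the equation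
`Σ_i C_i/(λ+α_i+1) = 1` has `N` distinct roots `σ_1,…,σ_N`, with characteristic exponent
`σ(G) = max_i Re(σ_i)`, then the solution of `ξ_p = (1/p) Σ_{q=2}^{p−1} G(q/p) ξ_q`
satisfies `|ξ_p| ≤ C · p^{σ(G)} · |ξ_2|` for all `p > 1`. -/
theorem stmt_5 (N : ℕ) (hN : 0 < N) (C α σ : Fin N → ℂ)
    (hσ : Function.Injective σ)
    (hden : ∀ k i, σ k + α i + 1 ≠ 0)
    (hroot : ∀ k, ∑ i, C i / (σ k + α i + 1) = 1)
    (hcomplete : ∀ lam : ℂ, (∀ i, lam + α i + 1 ≠ 0) →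
      (∑ i, C i / (lam + α i + 1) = 1) → ∃ k, lam = σ k)
    (G : ℝ → ℂ) (hG : ∀ γ : ℝ, G γ = ∑ i, C i * (γ : ℂ) ^ (α i))
    (ξ : ℕ → ℂ)
    (hrec : ∀ p : ℕ, 3 ≤ p →
      ξ p = (1 / (p : ℂ)) * ∑ q ∈ Finset.Ico 2 p, G ((q : ℝ) / (p : ℝ)) * ξ q) :
    ∃ K : ℝ, ∀ p : ℕ, 1 < p →
      ‖ξ p‖ ≤ K * (p : ℝ) ^ (Finset.univ.sup' (Finset.univ_nonempty_iff.mpr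
        ⟨⟨0, hN⟩⟩) fun i => (σ i).re) * ‖ξ 2‖ := by
  set s : ℝ := Finset.univ.sup' (Finset.univ_nonempty_iff.mpr
    ⟨⟨0, hN⟩⟩) fun i => (σ i).re with hs
  by_cases h2 : ξ 2 = 0
  · have hzero : ∀ p : ℕ, 1 < p → ξ p = 0 := by
      intro p
      induction p using Nat.strong_induction_on with
      | _ p ih =>
        intro hp
        rcases (show 2 ≤ p from hp).eq_or_lt with rfl | hp'
        · exact h2
        · rw [hrec p hp', Finset.sum_eq_zero, mul_zero]
          intro q hq
          rw [Finset.mem_Ico] at hq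
          rw [ih q hq.2 hq.1, mul_zero]
    exact ⟨0, fun p hp => by simp [hzero p hp]⟩
  have hb : (fun p : ℕ => (p : ℂ) ^ (-(s : ℂ)) * ξ p) =O[atTop] fun _ => (1 : ℝ) := by
    refine isBigO_one_of_recurrence C (fun i => α i + s) (fun k => σ k - s)
      (fun a b hab => hσ (sub_left_injective hab)) (fun k i => ?_) (fun k => ?_) (fun k => ?_) _ ?_
    · convert hden k i using 1
      ring
    · refine (Finset.sum_congr rfl fun i _ => ?_).trans (hroot k)
      congr 1
      ring
    · simpa using Finset.le_sup' (fun i => (σ i).re) (Finset.mem_univ k)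
    · intro p hp
      have hp0 : (p : ℂ) ≠ 0 := Nat.cast_ne_zero.2 (by omega)
      rw [hrec p hp, mul_left_comm, Finset.mul_sum]
      congr 1
      refine Finset.sum_congr rfl fun q hq => ?_
      have hq0 : (q : ℂ) ≠ 0 := Nat.cast_ne_zero.2 (by
        have := (Finset.mem_Ico.1 hq).1
        omega)
      have hdiv : ((q : ℂ) / p) ^ (s : ℂ) = (q : ℂ) ^ (s : ℂ) / (p : ℂ) ^ (s : ℂ) := by
        simpa using div_cpow_ofReal_nonneg q.cast_nonneg p.cast_nonneg (s : ℂ)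
      have hqs : (q : ℂ) ^ (s : ℂ) ≠ 0 := by simp [cpow_eq_zero_iff, hq0]
      simp only [cpow_add _ _ (div_ne_zero hq0 hp0), hdiv, hG, cpow_neg, ← mul_assoc]
      rw [← Finset.sum_mul]
      push_cast
      field_simp
  obtain ⟨K, hK, hbound⟩ := bound_of_isBigO_nat_atTop hb
  refine ⟨K / ‖ξ 2‖, fun p hp => ?_⟩
  have hp0 : (0 : ℝ) < p := by positivity
  have h := hbound (x := p) one_ne_zero
  rw [norm_mul, norm_one, mul_one, ← ofReal_natCast, norm_cpow_eq_rpow_re_of_pos hp0, neg_re,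
    ofReal_re, Real.rpow_neg hp0.le, inv_mul_le_iff₀ (by positivity)] at h
  have := norm_pos_iff.2 h2
  field_simp
  linarith
end

section
/- Assume 0 < σ < 1, C_2 > 0, and N_0 ≥ max{(2C_2/(2+σ))^{1/(1+σ)}, (4C_2)^{1/(3+σ)}}. Let p > N_0 and let (ξ_q) satisfy |ξ_q| ≤ C_2 · q^{−σ} for all N_0 < q < p. Then for every integer r with N_0 ≤ r < p, |∏_{r<q<p} (1 + ξ_q/q³)^{r} − 1| ≤ (2C_2/(2+σ)) · r^{−(1+σ)} · (1 − (r/p)^{2+σ}). -/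
open Finset

/-- One term of the integral comparison for `∑ q ^ (-(s + 1))`. -/
lemma rpow_neg_add_one_le_sub {s : ℝ} (hs : 0 < s) {x : ℝ} (hx : 0 < x) :
    (x + 1) ^ (-(s + 1)) ≤ (x ^ (-s) - (x + 1) ^ (-s)) / s := by
  have hx1 : 0 < x + 1 := by linarith
  have hexp : x / (x + 1) ≤ Real.exp (-(1 / (x + 1))) := by
    have h := Real.add_one_le_exp (-(1 / (x + 1)))
    have e : x / (x + 1) = -(1 / (x + 1)) + 1 := by field_simp; ring
    rwa [e]
  have hbern : 1 + s / (x + 1) ≤ (x / (x + 1)) ^ (-s) := by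
    calc 1 + s / (x + 1) ≤ Real.exp (s / (x + 1)) := by
          linarith [Real.add_one_le_exp (s / (x + 1))]
      _ = (Real.exp (-(1 / (x + 1)))) ^ (-s) := by
          rw [← Real.exp_mul]; congr 1; ring
      _ ≤ (x / (x + 1)) ^ (-s) :=
          Real.rpow_le_rpow_of_nonpos (by positivity) hexp (by linarith)
  have hpos : 0 < (x + 1) ^ (-s) := Real.rpow_pos_of_pos hx1 _
  rw [Real.div_rpow hx.le hx1.le, le_div_iff₀ hpos] at hbern
  have e : (x + 1) ^ (-(s + 1)) = (x + 1) ^ (-s) / (x + 1) := by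
    rw [← Real.rpow_sub_one hx1.ne']; congr 1; ring
  rw [e, le_div_iff₀ hs]
  calc (x + 1) ^ (-s) / (x + 1) * s
      = (1 + s / (x + 1)) * (x + 1) ^ (-s) - (x + 1) ^ (-s) := by ring
    _ ≤ _ := by linarith

/-- Integral comparison for the finite sums `∑ q ^ (-(s + 1))`. -/
lemma sum_Ioc_rpow_neg_add_one_le {s : ℝ} (hs : 0 < s) {r n : ℕ} (hr : 0 < r) (hn : r ≤ n) :
    ∑ q ∈ Finset.Ioc r n, (q : ℝ) ^ (-(s + 1)) ≤ ((r : ℝ) ^ (-s) - (n : ℝ) ^ (-s)) / s := by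
  induction n, hn using Nat.le_induction with
  | base => simp
  | succ n hn ih =>
    rw [Finset.sum_Ioc_succ_top hn]
    have h := rpow_neg_add_one_le_sub hs (x := n) (by exact_mod_cast hr.trans_le hn)
    push_cast
    calc _ ≤ ((r : ℝ) ^ (-s) - (n : ℝ) ^ (-s)) / s
          + ((n : ℝ) ^ (-s) - ((n : ℝ) + 1) ^ (-s)) / s := add_le_add ih h
      _ = _ := by ring

lemma abs_prod_one_add_pow_sub_one_le {ι : Type*} (t : Finset ι) (f : ι → ℝ) (r : ℕ) :
    |∏ q ∈ t, (1 + f q) ^ r - 1| ≤ Real.exp (r * ∑ q ∈ t, |f q|) - 1 := by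
  have h := Finset.norm_prod_one_add_sub_one_le (t ×ˢ Finset.range r) (fun x => f x.1)
  simpa [Finset.prod_product, Finset.sum_product, Finset.mul_sum] using h

/-- if `|ξ_q| ≤ C₂ q^{−σ}` for `N₀ < q < p` and
`N₀ ≥ max{(2C₂/(2+σ))^{1/(1+σ)}, (4C₂)^{1/(3+σ)}}`, then for `N₀ ≤ r < p`:
`|∏_{r<q<p} (1+ξ_q/q³)^r − 1| ≤ (2C₂/(2+σ)) r^{−(1+σ)} (1 − (r/p)^{2+σ})`. -/
theorem stmt_9 (σ : ℝ) (hσ0 : 0 < σ) (hσ1 : σ < 1)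
    (C₂ : ℝ) (hC₂ : 0 < C₂) (N₀ : ℕ)
    (hN₀ : (N₀ : ℝ) ≥ max ((2 * C₂ / (2 + σ)) ^ ((1:ℝ) / (1 + σ)))
      ((4 * C₂) ^ ((1:ℝ) / (3 + σ))))
    (p : ℕ) (hp : N₀ < p) (ξ : ℕ → ℝ)
    (hξ : ∀ q : ℕ, N₀ < q → q < p → |ξ q| ≤ C₂ * (q : ℝ) ^ (-σ)) :
    ∀ r : ℕ, N₀ ≤ r → r < p →
      |(∏ q ∈ Finset.Ioo r p, (1 + ξ q / (q : ℝ) ^ 3) ^ r) - 1|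
        ≤ (2 * C₂ / (2 + σ)) * (r : ℝ) ^ (-(1 + σ)) *
          (1 - ((r : ℝ) / (p : ℝ)) ^ ((2:ℝ) + σ)) := by
  intro r hr hrp
  obtain ⟨hN1, hN2⟩ := max_le_iff.mp hN₀
  have hN0 : (0 : ℝ) < N₀ := lt_of_lt_of_le (by positivity) hN1
  have hrN : (N₀ : ℝ) ≤ r := by exact_mod_cast hr
  have hr0 : (0 : ℝ) < r := hN0.trans_le hrN
  have hr0' : 0 < r := by exact_mod_cast hr0
  have hp0 : (0 : ℝ) < p := by exact_mod_cast hr0'.trans hrp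
  set T : ℝ := C₂ / (2 + σ) * (r : ℝ) ^ (-(1 + σ)) * (1 - ((r : ℝ) / p) ^ (2 + σ)) with hT
  have hsum : r * ∑ q ∈ Finset.Ioo r p, |ξ q / (q : ℝ) ^ 3| ≤ T := by
    calc r * ∑ q ∈ Finset.Ioo r p, |ξ q / (q : ℝ) ^ 3|
        ≤ r * ∑ q ∈ Finset.Ioo r p, C₂ * (q : ℝ) ^ (-((2 + σ) + 1)) := by
          gcongr with q hq
          obtain ⟨h1, h2⟩ := Finset.mem_Ioo.mp hq
          have hq0 : (0 : ℝ) < q := by exact_mod_cast hr0'.trans h1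
          have e : (q : ℝ) ^ (-((2 + σ) + 1)) = (q : ℝ) ^ (-σ) / (q : ℝ) ^ 3 := by
            rw [← Real.rpow_sub_natCast hq0.ne']; congr 1; push_cast; ring
          rw [e, abs_div, abs_of_pos (pow_pos hq0 3), ← mul_div_assoc]
          gcongr
          exact hξ q (hr.trans_lt h1) h2
      _ ≤ r * ∑ q ∈ Finset.Ioc r p, C₂ * (q : ℝ) ^ (-((2 + σ) + 1)) := by
          gcongr
          exact Finset.Ioo_subset_Ioc_self
      _ ≤ r * (C₂ * (((r : ℝ) ^ (-(2 + σ)) - (p : ℝ) ^ (-(2 + σ))) / (2 + σ))) := by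
          rw [← Finset.mul_sum]
          gcongr
          exact sum_Ioc_rpow_neg_add_one_le (by linarith) hr0' hrp.le
      _ = T := by
          have e1 : (r : ℝ) ^ (-(1 + σ)) = r * (r : ℝ) ^ (-(2 + σ)) := by
            rw [← Real.rpow_one_add' hr0.le (by linarith)]; congr 1; ring
          have e2 : (r : ℝ) ^ (-(2 + σ)) * (r : ℝ) ^ (2 + σ) = 1 := by
            rw [← Real.rpow_add hr0]; simp
          rw [hT, e1, Real.div_rpow hr0.le hp0.le, Real.rpow_neg hp0.le]
          linear_combination (r * C₂ / (2 + σ) * ((p : ℝ) ^ (2 + σ))⁻¹) * e2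
  have hT1 : T ≤ 1 := by
    have hpow : 2 * C₂ / (2 + σ) ≤ (r : ℝ) ^ (1 + σ) := by
      have h := Real.rpow_le_rpow (by positivity) (hN1.trans hrN) (by linarith : 0 ≤ 1 + σ)
      rwa [← Real.rpow_mul (by positivity), one_div_mul_cancel (by linarith), Real.rpow_one] at h
    have hA : 2 * C₂ / (2 + σ) * (r : ℝ) ^ (-(1 + σ)) ≤ 1 := by
      rw [Real.rpow_neg hr0.le, ← div_eq_mul_inv]
      exact div_le_one_of_le₀ hpow (by positivity)
    have hB : 0 ≤ ((r : ℝ) / p) ^ (2 + σ) := by positivity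
    have hC : 0 ≤ C₂ / (2 + σ) * (r : ℝ) ^ (-(1 + σ)) := by positivity
    have hD : 2 * (C₂ / (2 + σ) * (r : ℝ) ^ (-(1 + σ))) ≤ 1 := by
      convert hA using 1; ring
    nlinarith [mul_nonneg hC hB]
  have hT0 : 0 ≤ T := le_trans (by positivity) hsum
  calc _ ≤ Real.exp (r * ∑ q ∈ Finset.Ioo r p, |ξ q / (q : ℝ) ^ 3|) - 1 :=
        abs_prod_one_add_pow_sub_one_le _ _ _
    _ ≤ Real.exp T - 1 := by gcongr
    _ ≤ |Real.exp T - 1| := le_abs_self _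
    _ ≤ 2 * |T| := Real.abs_exp_sub_one_le (by rwa [abs_of_nonneg hT0])
    _ = _ := by rw [abs_of_nonneg hT0, hT]; ring
end

section
/- Let D_1 > 0 and let p_0 be an integer with p_0 ≥ max{2√D_1, 7}. Then for every real x with |x| ≤ D_1 and every integer p ≥ p_0: |p³·((1 + x/p²)^{−1/p} − 1) + x| ≤ 5x²/(4p²) ≤ 5D_1²/(4p²). -/
lemma sub_five_sixths_sq_le_log_one_add {t : ℝ} (ht : |t| ≤ 1 / 4) :
    t - 5 / 6 * t ^ 2 ≤ Real.log (1 + t) := by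
  have h := Real.abs_log_sub_add_sum_range_le (x := -t) (by rw [abs_neg]; linarith) 2
  norm_num [Finset.sum_range_succ] at h
  have hc : |t| ^ 3 / (1 - |t|) ≤ t ^ 2 / 3 := by
    rw [div_le_iff₀ (by linarith), ← sq_abs t]
    nlinarith [mul_nonneg (sq_nonneg |t|) (sub_nonneg.2 ht)]
  linarith [(abs_le.1 h).1]

/-- Second-order remainder bound for the binomial function with small negative exponent. -/
lemma abs_one_add_rpow_neg_sub_le {s t : ℝ} (hs : 0 ≤ s) (hs' : s ≤ 1 / 7) (ht : |t| ≤ 1 / 4) :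
    |(1 + t) ^ (-s) - 1 + s * t| ≤ 5 / 4 * s * t ^ 2 := by
  obtain ⟨h1, h2⟩ := abs_le.1 ht
  have hpos : 0 < 1 + t := by linarith
  have hlow := sub_five_sixths_sq_le_log_one_add ht
  have hup : Real.log (1 + t) ≤ t := by linarith [Real.log_le_sub_one_of_pos hpos]
  rw [Real.rpow_def_of_pos hpos]
  set M := t - 5 / 6 * t ^ 2 with hM
  have hM1 : -1 ≤ M := by nlinarith
  have hsM : 0 < 1 + s * M := by nlinarith
  have hle : Real.exp (Real.log (1 + t) * -s) ≤ (1 + s * M)⁻¹ := by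
    have h3 : Real.exp (Real.log (1 + t) * -s) ≤ Real.exp (-(s * M)) :=
      Real.exp_le_exp.2 (by nlinarith)
    rw [Real.exp_neg] at h3
    exact h3.trans (inv_anti₀ hsM (by linarith [Real.add_one_le_exp (s * M)]))
  have hfac : (1 - 5 / 6 * t) * (1 - 5 / 4 * t) ≤ 2 := by nlinarith
  have hinv : (1 + s * M)⁻¹ ≤ 1 - s * t + 5 / 4 * s * t ^ 2 := by
    rw [inv_le_iff_one_le_mul₀ hsM]
    have hfactor : 0 ≤ 5 / 12 - s * ((1 - 5 / 6 * t) * (1 - 5 / 4 * t)) := by nlinarith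
    have hprod := mul_nonneg (mul_nonneg hs (sq_nonneg t)) hfactor
    rw [hM]
    linarith
  have hge := Real.add_one_le_exp (Real.log (1 + t) * -s)
  have hrem : 0 ≤ s * t ^ 2 := by positivity
  rw [abs_le]
  constructor <;> nlinarith


/-- Lemma 6.2: for `|x| ≤ D₁` and integers `p ≥ p₀ ≥ max{2√D₁, 7}`:
`|p³((1 + x/p²)^{−1/p} − 1) + x| ≤ 5x²/(4p²) ≤ 5D₁²/(4p²)`. -/
theorem stmt_11 (D₁ : ℝ) (hD₁ : 0 < D₁) (p₀ : ℕ)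
    (hp₀ : (p₀ : ℝ) ≥ max (2 * Real.sqrt D₁) 7)
    (x : ℝ) (hx : |x| ≤ D₁) (p : ℕ) (hp : p₀ ≤ p) :
    |(p : ℝ) ^ 3 * ((1 + x / (p : ℝ) ^ 2) ^ (-(1 / (p : ℝ))) - 1) + x|
        ≤ 5 * x ^ 2 / (4 * (p : ℝ) ^ 2) ∧
      5 * x ^ 2 / (4 * (p : ℝ) ^ 2) ≤ 5 * D₁ ^ 2 / (4 * (p : ℝ) ^ 2) := by
  have hp₀p : (p₀ : ℝ) ≤ p := by exact_mod_cast hp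
  have h7 : (7 : ℝ) ≤ p := (le_max_right _ _).trans (hp₀.trans hp₀p)
  have hsqrt : 2 * Real.sqrt D₁ ≤ p := (le_max_left _ _).trans (hp₀.trans hp₀p)
  have hpos : (0 : ℝ) < p := by linarith
  refine ⟨?_, ?_⟩
  · have hD : 4 * D₁ ≤ (p : ℝ) ^ 2 := by
      nlinarith [Real.sq_sqrt hD₁.le, Real.sqrt_nonneg D₁]
    have ht : |x / (p : ℝ) ^ 2| ≤ 1 / 4 := by
      rw [abs_div, abs_of_pos (by positivity : (0 : ℝ) < (p : ℝ) ^ 2),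
        div_le_iff₀ (by positivity)]
      linarith
    have h := abs_one_add_rpow_neg_sub_le (s := 1 / (p : ℝ)) (by positivity)
      (one_div_le_one_div_of_le (by norm_num) h7) ht
    have heq : (p : ℝ) ^ 3 * ((1 + x / (p : ℝ) ^ 2) ^ (-(1 / (p : ℝ))) - 1) + x
        = (p : ℝ) ^ 3 * ((1 + x / (p : ℝ) ^ 2) ^ (-(1 / (p : ℝ))) - 1
          + 1 / (p : ℝ) * (x / (p : ℝ) ^ 2)) := by
      rw [mul_add _ (_ - 1)]
      congr 1
      field_simp
    rw [heq, abs_mul, abs_of_pos (by positivity : (0 : ℝ) < (p : ℝ) ^ 3)]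
    refine (mul_le_mul_of_nonneg_left h (by positivity)).trans_eq ?_
    field_simp
  · have hsq : x ^ 2 ≤ D₁ ^ 2 := sq_le_sq.2 (hx.trans (le_abs_self D₁))
    gcongr
end

section
/- Let A > 0 and let N_0 ≥ max{1, A} be an integer. Suppose |ξ_q| ≤ A for all integers q ≥ N_0. Then for all integers p_1 ≥ N_0 and all p > p_1: |∏_{p_1<q<p} (1 + ξ_q/q³)^{p_1} − (1 + p_1 · Σ_{p_1<q<p} ξ_q/q³)| ≤ A²/(4p_1²). -/
open Finset

/-- The error of the first-order expansion of `∏ (1 + f i)` is at most the corresponding error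
for the exponential of `∑ |f i|`. -/
lemma abs_prod_one_add_sub_one_add_sum_le {ι : Type*} (s : Finset ι) (f : ι → ℝ) :
    |(∏ i ∈ s, (1 + f i)) - (1 + ∑ i ∈ s, f i)|
      ≤ Real.exp (∑ i ∈ s, |f i|) - 1 - ∑ i ∈ s, |f i| := by
  classical
  induction s using Finset.induction_on with
  | empty => simp
  | insert a s ha ih =>
    rw [prod_insert ha, sum_insert ha, sum_insert ha, Real.exp_add]
    have h1 : |(∏ i ∈ s, (1 + f i)) - 1| ≤ Real.exp (∑ i ∈ s, |f i|) - 1 :=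
      s.norm_prod_one_add_sub_one_le f
    set P := ∏ i ∈ s, (1 + f i)
    set E := Real.exp (∑ i ∈ s, |f i|)
    have h2 : (1 + f a) * P - (1 + (f a + ∑ i ∈ s, f i))
        = (P - (1 + ∑ i ∈ s, f i)) + f a * (P - 1) := by ring
    have h3 : |f a * (P - 1)| ≤ |f a| * (E - 1) := by
      rw [abs_mul]
      exact mul_le_mul_of_nonneg_left h1 (abs_nonneg _)
    have h4 : 0 ≤ E * (Real.exp |f a| - (|f a| + 1)) :=
      mul_nonneg (Real.exp_pos _).le (sub_nonneg.2 (Real.add_one_le_exp _))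
    rw [h2]
    refine (abs_add_le _ _).trans ?_
    linarith

lemma sum_Ioo_one_div_cube_le {n p : ℕ} (hn : 1 ≤ n) (hp : n < p) :
    ∑ q ∈ Ioo n p, 1 / (q : ℝ) ^ 3 ≤ 1 / (2 * (n : ℝ) * (n + 1)) := by
  have hn' : (1 : ℝ) ≤ n := by exact_mod_cast hn
  suffices h : ∑ q ∈ Ioo n p, 1 / (q : ℝ) ^ 3
      ≤ 1 / (2 * (n : ℝ) * (n + 1)) - 1 / (2 * ((p : ℝ) - 1) * p) by
    have hp' : (n : ℝ) + 1 ≤ p := by exact_mod_cast hp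
    have : 0 ≤ 1 / (2 * ((p : ℝ) - 1) * p) := by
      have : 0 ≤ (p : ℝ) - 1 := by linarith
      positivity
    linarith
  induction p, hp using Nat.le_induction with
  | base =>
    have : Ioo n (n + 1) = ∅ := by ext; simp
    simp [this]
  | succ p hp ih =>
    have hp' : (n : ℝ) + 1 ≤ p := by exact_mod_cast hp
    have hI : Ioo n (p + 1) = insert p (Ioo n p) := by ext; simp; omega
    rw [Nat.succ_eq_add_one] at *
    rw [hI, sum_insert (by simp)]
    have key : 1 / (p : ℝ) ^ 3 ≤ 1 / (2 * ((p : ℝ) - 1) * p) - 1 / (2 * p * (p + 1)) := by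
      obtain ⟨x, hx⟩ : ∃ x : ℝ, x = p - 1 := ⟨_, rfl⟩
      have hx0 : 0 < x := by linarith
      have hpx : (p : ℝ) = x + 1 := by linarith
      rw [hpx, add_sub_cancel_right]
      have : 1 / (2 * x * (x + 1)) - 1 / (2 * (x + 1) * (x + 1 + 1))
          = 1 / (x * (x + 1) * (x + 2)) := by
        field_simp
        ring
      rw [this]
      apply one_div_le_one_div_of_le (by positivity)
      nlinarith
    push_cast
    rw [add_sub_cancel_right]
    linarith

/-- Lemma 6.6: if `|ξ_q| ≤ A` for `q ≥ N₀ ≥ max{1, A}`, then for all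
`p₁ ≥ N₀` and `p > p₁`:
`|∏_{p₁<q<p} (1+ξ_q/q³)^{p₁} − (1 + p₁ Σ_{p₁<q<p} ξ_q/q³)| ≤ A²/(4p₁²)`. -/
theorem stmt_15 (A : ℝ) (hA : 0 < A) (N₀ : ℕ) (hN₀1 : 1 ≤ N₀) (hN₀A : A ≤ (N₀ : ℝ))
    (ξ : ℕ → ℝ) (hξ : ∀ q : ℕ, N₀ ≤ q → |ξ q| ≤ A) :
    ∀ p1 p : ℕ, N₀ ≤ p1 → p1 < p →
      |(∏ q ∈ Finset.Ioo p1 p, (1 + ξ q / (q : ℝ) ^ 3) ^ p1)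
          - (1 + (p1 : ℝ) * ∑ q ∈ Finset.Ioo p1 p, ξ q / (q : ℝ) ^ 3)|
        ≤ A ^ 2 / (4 * (p1 : ℝ) ^ 2) := by
  intro n p hn hp
  have hn1 : 1 ≤ n := hN₀1.trans hn
  have hn1' : (1 : ℝ) ≤ n := by exact_mod_cast hn1
  have hAn : A ≤ n := hN₀A.trans (by exact_mod_cast hn)
  have h := abs_prod_one_add_sub_one_add_sum_le (Ioo n p ×ˢ range n)
    (fun x => ξ x.1 / (x.1 : ℝ) ^ 3)
  simp only [prod_product, sum_product, prod_const, sum_const, card_range, nsmul_eq_mul,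
    ← mul_sum] at h
  refine h.trans ?_
  set S := (n : ℝ) * ∑ q ∈ Ioo n p, |ξ q / (q : ℝ) ^ 3|
  have hS0 : 0 ≤ S := by positivity
  have hS : S ≤ A / (2 * n) := by
    have h1 : ∑ q ∈ Ioo n p, |ξ q / (q : ℝ) ^ 3| ≤ A * ∑ q ∈ Ioo n p, 1 / (q : ℝ) ^ 3 := by
      rw [mul_sum]
      refine sum_le_sum fun q hq => ?_
      have hq' : N₀ ≤ q := hn.trans (mem_Ioo.1 hq).1.le
      rw [abs_div, abs_of_nonneg (by positivity : (0 : ℝ) ≤ (q : ℝ) ^ 3), mul_one_div]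
      exact div_le_div_of_nonneg_right (hξ q hq') (by positivity)
    calc S ≤ n * (A * (1 / (2 * n * (n + 1)))) := by
          refine mul_le_mul_of_nonneg_left (h1.trans ?_) (by positivity)
          exact mul_le_mul_of_nonneg_left (sum_Ioo_one_div_cube_le hn1 hp) hA.le
      _ = A / (2 * (n + 1)) := by field_simp
      _ ≤ A / (2 * n) := by gcongr; linarith
  have hS1 : S ≤ 1 := hS.trans <| by
    rw [div_le_one (by positivity)]
    linarith
  calc Real.exp S - 1 - S ≤ S ^ 2 :=
        (le_abs_self _).trans (Real.abs_exp_sub_one_sub_id_le (by rwa [abs_of_nonneg hS0]))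
    _ ≤ (A / (2 * n)) ^ 2 := by gcongr
    _ = A ^ 2 / (4 * (n : ℝ) ^ 2) := by ring
end

section
/- Let f̃ : [0,1] → ℝ be twice continuously differentiable. Then for all integers p ≥ 2 and 2 ≤ q ≤ p: |(1/(p−1)) · Σ_{p_1=1}^{q−1} f̃′(p_1/p) · (p_1/p)² − ∫_0^{q/p} f̃′(γ)·γ² dγ| ≤ ‖f̃′‖_∞ · ( q³/(3p⁴) + 2q²/p³ ) + ‖f̃″‖_∞ · q²/(2p³). -/
open Finset

/-- The supremum norm of `g` on `[0,1]`. -/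
noncomputable def supNorm01 (g : ℝ → ℝ) : ℝ :=
  sSup ((fun γ => |g γ|) '' Set.Icc (0:ℝ) 1)

theorem abs_le_supNorm01 {g : ℝ → ℝ} (hg : Continuous g) {x : ℝ} (hx : x ∈ Set.Icc (0:ℝ) 1) :
    |g x| ≤ supNorm01 g :=
  le_csSup (isCompact_Icc.image hg.abs).bddAbove (Set.mem_image_of_mem _ hx)

theorem supNorm01_nonneg (g : ℝ → ℝ) : 0 ≤ supNorm01 g :=
  Real.sSup_nonneg (by rintro _ ⟨x, -, rfl⟩; exact abs_nonneg _)

theorem sum_range_sq_cast (n : ℕ) :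
    ∑ k ∈ range n, (k : ℝ) ^ 2 = ((n : ℝ) - 1) * n * (2 * n - 1) / 6 := by
  induction n with
  | zero => simp
  | succ n ih => rw [sum_range_succ, ih]; push_cast; ring

/-- Error of the left rectangle rule on one interval. -/
theorem abs_left_rectangle_sub_integral_le {h h' : ℝ → ℝ} {a b C : ℝ} (hab : a ≤ b)
    (hh : ∀ x, HasDerivAt h (h' x) x) (hC : ∀ x ∈ Set.Icc a b, |h' x| ≤ C) :
    |(b - a) * h a - ∫ x in a..b, h x| ≤ C * (b - a) ^ 2 / 2 := by
  have hc : Continuous h := continuous_iff_continuousAt.2 fun x => (hh x).continuousAt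
  have key : ‖∫ x in a..b, (h a - h x)‖ ≤ ∫ x in a..b, C * (x - a) := by
    refine intervalIntegral.norm_integral_le_of_norm_le hab (.of_forall fun x hx => ?_)
      (Continuous.intervalIntegrable (by fun_prop) _ _)
    have hx' : x ∈ Set.Icc a b := Set.Ioc_subset_Icc_self hx
    have := (convex_Icc a b).norm_image_sub_le_of_norm_hasDerivWithin_le
      (fun y _ => (hh y).hasDerivWithinAt) hC (Set.left_mem_Icc.2 hab) hx'
    rwa [Real.norm_of_nonneg (sub_nonneg.2 hx'.1), norm_sub_rev] at this
  rw [intervalIntegral.integral_sub (by simp) (hc.intervalIntegrable _ _),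
    intervalIntegral.integral_const, smul_eq_mul, Real.norm_eq_abs] at key
  refine key.trans_eq ?_
  rw [intervalIntegral.integral_const_mul, intervalIntegral.integral_sub (by simp) (by simp),
    integral_id, intervalIntegral.integral_const, smul_eq_mul]
  ring

/-- Error of the composite left rectangle rule with step `1 / p` on `[0, q / p]`. -/
theorem abs_left_riemann_sum_sub_integral_le {h h' : ℝ → ℝ} {p : ℕ} (hp : 0 < p) (q : ℕ) {C : ℝ}
    (hh : ∀ x, HasDerivAt h (h' x) x)
    (hC : ∀ x ∈ Set.Icc (0:ℝ) ((q : ℝ) / p), |h' x| ≤ C) :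
    |1 / (p : ℝ) * ∑ k ∈ range q, h ((k : ℝ) / p) - ∫ x in (0:ℝ)..((q : ℝ) / p), h x|
      ≤ q * (C * (1 / (p : ℝ)) ^ 2 / 2) := by
  have hp0 : (0:ℝ) < p := by exact_mod_cast hp
  have hc : Continuous h := continuous_iff_continuousAt.2 fun x => (hh x).continuousAt
  have hsum := intervalIntegral.sum_integral_adjacent_intervals (f := h)
    (μ := MeasureTheory.volume) (a := fun k : ℕ => (k : ℝ) / p) (n := q)
    fun k _ => hc.intervalIntegrable _ _
  simp only [Nat.cast_zero, zero_div] at hsum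
  rw [← hsum, mul_sum, ← sum_sub_distrib]
  refine (abs_sum_le_sum_abs _ _).trans ?_
  rw [← nsmul_eq_mul]
  conv_rhs => rw [← card_range q]
  refine sum_le_card_nsmul _ _ _ fun k hk => ?_
  have hkq : ((k + 1 : ℕ) : ℝ) ≤ q := by exact_mod_cast mem_range.1 hk
  have hstep : ((k + 1 : ℕ) : ℝ) / p - (k : ℝ) / p = 1 / p := by push_cast; ring
  have hle : (k : ℝ) / p ≤ ((k + 1 : ℕ) : ℝ) / p := by gcongr; simp
  have := abs_left_rectangle_sub_integral_le hle hh fun x hx =>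
    hC x ⟨le_trans (by positivity) hx.1, hx.2.trans (by gcongr)⟩
  rwa [hstep] at this

/-- for `f̃` twice continuously differentiable, all integers `p ≥ 2` and
`2 ≤ q ≤ p`:
`|(1/(p−1)) Σ_{p₁=1}^{q−1} f̃′(p₁/p)(p₁/p)² − ∫_0^{q/p} f̃′(γ)γ² dγ|
  ≤ ‖f̃′‖_∞ (q³/(3p⁴) + 2q²/p³) + ‖f̃″‖_∞ q²/(2p³)`. -/
theorem stmt_18 (ftil : ℝ → ℝ) (hf : ContDiff ℝ 2 ftil)
    (p q : ℕ) (hp : 2 ≤ p) (hq2 : 2 ≤ q) (hqp : q ≤ p) :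
    |(1 / ((p : ℝ) - 1)) *
        (∑ p1 ∈ Finset.Ico 1 q, deriv ftil ((p1 : ℝ) / (p : ℝ)) * ((p1 : ℝ) / (p : ℝ)) ^ 2)
      - ∫ γ in (0:ℝ)..((q : ℝ) / (p : ℝ)), deriv ftil γ * γ ^ 2|
      ≤ supNorm01 (deriv ftil) * ((q : ℝ) ^ 3 / (3 * (p : ℝ) ^ 4) +
          2 * (q : ℝ) ^ 2 / (p : ℝ) ^ 3) +
        supNorm01 (deriv (deriv ftil)) * (q : ℝ) ^ 2 / (2 * (p : ℝ) ^ 3) := by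
  have hd : ContDiff ℝ 1 (deriv ftil) :=
    ((contDiff_succ_iff_deriv (n := 1)).1 (by simpa [one_add_one_eq_two] using hf)).2.2
  have hdc : Continuous (deriv ftil) := hd.continuous
  have hddc : Continuous (deriv (deriv ftil)) := hd.continuous_deriv le_rfl
  set A := supNorm01 (deriv ftil)
  set B := supNorm01 (deriv (deriv ftil))
  have hA : 0 ≤ A := supNorm01_nonneg _
  have hB : 0 ≤ B := supNorm01_nonneg _
  have hp' : (2:ℝ) ≤ p := by exact_mod_cast hp
  have hq' : (2:ℝ) ≤ q := by exact_mod_cast hq2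
  have hqp' : (q:ℝ) ≤ p := by exact_mod_cast hqp
  have hp0 : (0:ℝ) < p := by linarith
  have hp1 : (0:ℝ) < (p:ℝ) - 1 := by linarith
  have hq1 : (q:ℝ) / p ≤ 1 := (div_le_one hp0).2 hqp'
  have hS : ∑ k ∈ Ico 1 q, deriv ftil ((k : ℝ) / p) * ((k : ℝ) / p) ^ 2
      = ∑ k ∈ range q, deriv ftil ((k : ℝ) / p) * ((k : ℝ) / p) ^ 2 := by
    rw [range_eq_Ico, sum_eq_sum_Ico_succ_bot (by omega : 0 < q)]
    simp
  have hriemann := abs_left_riemann_sum_sub_integral_le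
    (h := fun x => deriv ftil x * x ^ 2)
    (h' := fun x => deriv (deriv ftil) x * x ^ 2 + deriv ftil x * (2 * x))
    (p := p) (by omega) q (C := B * (q / p) ^ 2 + A * (2 * (q / p)))
    (fun x => by
      have hderiv := (hd.differentiable one_ne_zero x).hasDerivAt.mul (hasDerivAt_pow 2 x)
      rw [Nat.cast_ofNat, pow_one] at hderiv
      exact hderiv)
    (fun x hx => by
      have hx1 : x ∈ Set.Icc (0:ℝ) 1 := ⟨hx.1, hx.2.trans hq1⟩
      have h0 := hx.1
      refine (abs_add_le _ _).trans ?_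
      rw [abs_mul, abs_mul, abs_of_nonneg (sq_nonneg x), abs_of_nonneg (by linarith : 0 ≤ 2 * x)]
      gcongr
      exacts [abs_le_supNorm01 hddc hx1, hx.2, abs_le_supNorm01 hdc hx1, hx.2])
  have hSabs : |∑ k ∈ range q, deriv ftil ((k : ℝ) / p) * ((k : ℝ) / p) ^ 2|
      ≤ A / p ^ 2 * (((q : ℝ) - 1) * q * (2 * q - 1) / 6) := by
    rw [← sum_range_sq_cast, mul_sum]
    refine (abs_sum_le_sum_abs _ _).trans (sum_le_sum fun k hk => ?_)
    have hkq : (k : ℝ) ≤ q := by exact_mod_cast (mem_range.1 hk).le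
    have hk1 : (k : ℝ) / p ∈ Set.Icc (0:ℝ) 1 :=
      ⟨by positivity, (div_le_one hp0).2 (hkq.trans hqp')⟩
    rw [abs_mul, abs_of_nonneg (sq_nonneg ((k : ℝ) / p))]
    calc _ ≤ A * ((k : ℝ) / p) ^ 2 := by
          gcongr
          exact abs_le_supNorm01 hdc hk1
      _ = _ := by ring
  rw [hS]
  set S := ∑ k ∈ range q, deriv ftil ((k : ℝ) / p) * ((k : ℝ) / p) ^ 2
  set I := ∫ γ in (0:ℝ)..((q : ℝ) / (p : ℝ)), deriv ftil γ * γ ^ 2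
  have hweight : |1 / ((p : ℝ) * (p - 1)) * S| ≤ A * ((q : ℝ) ^ 3 / (3 * (p : ℝ) ^ 4)) := by
    rw [abs_mul, abs_of_pos (by positivity)]
    have hratio : ((q : ℝ) - 1) / (p - 1) ≤ q / p := by
      rw [div_le_div_iff₀ hp1 hp0]; linarith
    calc _ ≤ 1 / ((p : ℝ) * (p - 1)) * (A / p ^ 2 * (((q : ℝ) - 1) * q * (2 * q - 1) / 6)) := by
          gcongr
      _ = A * q / (6 * p ^ 3) * ((((q : ℝ) - 1) / (p - 1)) * (2 * q - 1)) := by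
          field_simp
      _ ≤ A * q / (6 * p ^ 3) * ((q / p) * (2 * q)) := by
          gcongr
          all_goals linarith
      _ = _ := by field_simp; ring
  have hsplit : 1 / ((p : ℝ) - 1) * S - I
      = 1 / ((p : ℝ) * (p - 1)) * S + (1 / (p : ℝ) * S - I) := by
    field_simp; ring
  have hcurv : B * (q : ℝ) ^ 2 / (2 * p ^ 3) * (q / p) ≤ B * (q : ℝ) ^ 2 / (2 * p ^ 3) :=
    mul_le_of_le_one_right (by positivity) hq1
  have hslope : 0 ≤ A * ((q : ℝ) ^ 2 / p ^ 3) := by positivity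
  have herr : (q : ℝ) * ((B * (q / p) ^ 2 + A * (2 * (q / p))) * (1 / (p : ℝ)) ^ 2 / 2)
      = B * (q : ℝ) ^ 2 / (2 * p ^ 3) * (q / p) + A * ((q : ℝ) ^ 2 / p ^ 3) := by
    field_simp
  rw [hsplit]
  refine (abs_add_le _ _).trans ((add_le_add hweight (hriemann.trans_eq herr)).trans ?_)
  rw [mul_add, mul_div_assoc 2]
  linarith
end
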